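/- Let α, β ∈ ℝ with α ≠ 0, and let u : ℝ × ℝ × ℝ → ℝ be a smooth solution of the Zakharov–Kuznetsov equation. Define the density ρ(t,x,y) = t u² − (2/α) x u and the flux components J¹ = t ((2α/3) u³ − β (u_x² − u_y²) + 2β u (u_{xx} + u_{yy})) − (2/α) x ((α/2) u² + β u_{xx}) + (2β/α) u_x and J² = −2β (t u_x u_y + (1/α) x u_{xy}). Then at every point (t,x,y), ∂_t ρ + ∂_x J¹ + ∂_y J² = 0 (this conservation law expresses conservation of the center of mass). -/

import Mathlib

/-- Partial derivative with respect to `t` of `u(t,x,y)`. -/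
noncomputable def pt (u : ℝ × ℝ × ℝ → ℝ) : ℝ × ℝ × ℝ → ℝ :=
  fun p => deriv (fun s => u (s, p.2.1, p.2.2)) p.1

/-- Partial derivative with respect to `x` of `u(t,x,y)`. -/
noncomputable def px (u : ℝ × ℝ × ℝ → ℝ) : ℝ × ℝ × ℝ → ℝ :=
  fun p => deriv (fun s => u (p.1, s, p.2.2)) p.2.1

/-- Partial derivative with respect to `y` of `u(t,x,y)`. -/
noncomputable def py (u : ℝ × ℝ × ℝ → ℝ) : ℝ × ℝ × ℝ → ℝ :=
  fun p => deriv (fun s => u (p.1, p.2.1, s)) p.2.2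

/-- `u` is a smooth solution of the Zakharov–Kuznetsov equation
`u_t + α u u_x + β (u_{xxx} + u_{xyy}) = 0`. -/
def IsZKSolution (α β : ℝ) (u : ℝ × ℝ × ℝ → ℝ) : Prop :=
  ContDiff ℝ (⊤ : ℕ∞) u ∧
    ∀ p : ℝ × ℝ × ℝ,
      pt u p + α * u p * px u p + β * (px (px (px u)) p + px (py (py u)) p) = 0

open scoped ContDiff

theorem px_eq_fderiv {u : ℝ × ℝ × ℝ → ℝ} (hu : Differentiable ℝ u) :
    px u = fun p => fderiv ℝ u p (0, 1, 0) := by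
  funext p
  have h : HasDerivAt (fun s : ℝ => (p.1, s, p.2.2)) ((0 : ℝ), (1 : ℝ), (0 : ℝ)) p.2.1 :=
    (hasDerivAt_const _ _).prodMk ((hasDerivAt_id _).prodMk (hasDerivAt_const _ _))
  exact ((hu p).hasFDerivAt.comp_hasDerivAt p.2.1 h).deriv

theorem py_eq_fderiv {u : ℝ × ℝ × ℝ → ℝ} (hu : Differentiable ℝ u) :
    py u = fun p => fderiv ℝ u p (0, 0, 1) := by
  funext p
  have h : HasDerivAt (fun s : ℝ => (p.1, p.2.1, s)) ((0 : ℝ), (0 : ℝ), (1 : ℝ)) p.2.2 :=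
    (hasDerivAt_const _ _).prodMk ((hasDerivAt_const _ _).prodMk (hasDerivAt_id _))
  exact ((hu p).hasFDerivAt.comp_hasDerivAt p.2.2 h).deriv

theorem hasDerivAt_pt {u : ℝ × ℝ × ℝ → ℝ} (hu : Differentiable ℝ u) (t x y : ℝ) :
    HasDerivAt (fun s => u (s, x, y)) (pt u (t, x, y)) t :=
  DifferentiableAt.hasDerivAt (f := fun s => u (s, x, y)) (by fun_prop)

theorem hasDerivAt_px {u : ℝ × ℝ × ℝ → ℝ} (hu : Differentiable ℝ u) (t x y : ℝ) :
    HasDerivAt (fun s => u (t, s, y)) (px u (t, x, y)) x :=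
  DifferentiableAt.hasDerivAt (f := fun s => u (t, s, y)) (by fun_prop)

theorem hasDerivAt_py {u : ℝ × ℝ × ℝ → ℝ} (hu : Differentiable ℝ u) (t x y : ℝ) :
    HasDerivAt (fun s => u (t, x, s)) (py u (t, x, y)) y :=
  DifferentiableAt.hasDerivAt (f := fun s => u (t, x, s)) (by fun_prop)

theorem contDiff_px {u : ℝ × ℝ × ℝ → ℝ} (hu : ContDiff ℝ ∞ u) : ContDiff ℝ ∞ (px u) := by
  rw [px_eq_fderiv (hu.differentiable (by simp))]
  exact (hu.fderiv_right (m := ∞) (by simp)).clm_apply contDiff_const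

theorem contDiff_py {u : ℝ × ℝ × ℝ → ℝ} (hu : ContDiff ℝ ∞ u) : ContDiff ℝ ∞ (py u) := by
  rw [py_eq_fderiv (hu.differentiable (by simp))]
  exact (hu.fderiv_right (m := ∞) (by simp)).clm_apply contDiff_const

/-- Mixed partial derivatives of a smooth function commute. -/
theorem py_px_comm {u : ℝ × ℝ × ℝ → ℝ} (hu : ContDiff ℝ ∞ u) : py (px u) = px (py u) := by
  have hd : Differentiable ℝ u := hu.differentiable (by simp)
  have hd' : Differentiable ℝ (fderiv ℝ u) :=
    (hu.fderiv_right (m := ∞) (by simp)).differentiable (by simp)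
  rw [py_eq_fderiv ((contDiff_px hu).differentiable (by simp)),
    px_eq_fderiv ((contDiff_py hu).differentiable (by simp)),
    px_eq_fderiv hd, py_eq_fderiv hd]
  funext p
  have hs : IsSymmSndFDerivAt ℝ u p :=
    hu.contDiffAt.isSymmSndFDerivAt (by simpa using WithTop.coe_le_coe.2 (le_top : (2 : ℕ∞) ≤ ⊤))
  rw [fderiv_clm_apply (hd' p) (by fun_prop), fderiv_clm_apply (hd' p) (by fun_prop)]
  simpa using hs.eq (0, 0, 1) (0, 1, 0)

/-- Conservation of the center of mass for the ZK equation: for every smooth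
solution `u`, the density `ρ = t u² − (2/α) x u` and the flux `(J¹, J²)` below
satisfy `D_t ρ + D_x J¹ + D_y J² = 0`. -/
theorem zk_center_of_mass_conservation_law (α β : ℝ) (hα : α ≠ 0)
    (u : ℝ × ℝ × ℝ → ℝ) (hu : IsZKSolution α β u) :
    ∀ p : ℝ × ℝ × ℝ,
      pt (fun q => q.1 * u q ^ 2 - (2 / α) * q.2.1 * u q) p
        + px (fun q =>
            q.1 * ((2 * α / 3) * u q ^ 3 - β * ((px u q) ^ 2 - (py u q) ^ 2)
              + 2 * β * u q * (px (px u) q + py (py u) q))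
            - (2 / α) * q.2.1 * ((α / 2) * u q ^ 2 + β * px (px u) q)
            + (2 * β / α) * px u q) p
        + py (fun q =>
            -2 * β * (q.1 * px u q * py u q + (1 / α) * q.2.1 * px (py u) q)) p = 0 := by
  obtain ⟨hc, hzk⟩ := hu
  rintro ⟨t, x, y⟩
  have diff {v : ℝ × ℝ × ℝ → ℝ} (hv : ContDiff ℝ ∞ v) : Differentiable ℝ v :=
    hv.differentiable (by simp)
  have ut := hasDerivAt_pt (diff hc) t x y
  have ux := hasDerivAt_px (diff hc) t x y
  have uxx := hasDerivAt_px (diff (contDiff_px hc)) t x y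
  have uyx := hasDerivAt_px (diff (contDiff_py hc)) t x y
  have uxxx := hasDerivAt_px (diff (contDiff_px (contDiff_px hc))) t x y
  have uyyx := hasDerivAt_px (diff (contDiff_py (contDiff_py hc))) t x y
  have uxy := hasDerivAt_py (diff (contDiff_px hc)) t x y
  have uyy := hasDerivAt_py (diff (contDiff_py hc)) t x y
  have uyxy := hasDerivAt_py (diff (contDiff_px (contDiff_py hc))) t x y
  rw [py_px_comm hc] at uxy
  rw [py_px_comm (contDiff_py hc)] at uyxy
  have hρ := ((hasDerivAt_id t).mul (ut.pow 2)).sub (ut.const_mul ((2 / α) * x))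
  have hx := (((hasDerivAt_id x).const_mul (2 / α)).mul
    (((ux.pow 2).const_mul (α / 2)).add (uxxx.const_mul β)))
  have hJ₁ := ((((((ux.pow 3).const_mul (2 * α / 3)).sub
    (((uxx.pow 2).sub (uyx.pow 2)).const_mul β)).add
    ((ux.const_mul (2 * β)).mul (uxxx.add uyyx))).const_mul t).sub hx).add
    (uxx.const_mul (2 * β / α))
  have hJ₂ := (((uxy.const_mul t).mul uyy).add (uyxy.const_mul ((1 / α) * x))).const_mul (-2 * β)
  have hz := hzk (t, x, y)
  refine (congrArg₂ (· + ·) (congrArg₂ (· + ·) hρ.deriv hJ₁.deriv) hJ₂.deriv).trans ?_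
  simp only [id, Pi.pow_apply, Pi.add_apply]
  field_simp
  linear_combination 6 * (α * t * u (t, x, y) - x) * hz
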